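/- Let I ⊆ {1, …, |V|} and i ∈ {1, …, |V|} \ I. Then for every j ∈ {1, …, |V|}, the number of occurrences of the symbol $_i in bexp_I(N_j) equals the number of occurrences of the string bexp_I(N_i) in bexp_I(N_j); moreover, any two occurrences of bexp_I(N_i) in bexp_I(N_j) are non-overlapping. -/

import Mathlib

/-- A straight-line grammar (SLG) over terminal alphabet `T` with set of nonterminals `N`:
every nonterminal has exactly one production rule (symbols are `N ⊕ T`). -/
structure SLG (T : Type) (N : Type) where
  start : N
  rhs : N → List (N ⊕ T)

namespace SLG

variable {T N : Type}

/-- One rewriting step: replace one occurrence of a nonterminal by its right-hand side. -/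
def Produces (G : SLG T N) (x y : List (N ⊕ T)) : Prop :=
  ∃ (p q : List (N ⊕ T)) (X : N),
    x = p ++ Sum.inl X :: q ∧ y = p ++ G.rhs X ++ q

/-- The derivation relation of an SLG. -/
def Derives (G : SLG T N) : List (N ⊕ T) → List (N ⊕ T) → Prop :=
  Relation.ReflTransGen G.Produces

/-- `u` is the (necessarily unique) expansion `exp_G(X)` of the nonterminal `X`. -/
def IsExp (G : SLG T N) (X : N) (u : List T) : Prop :=
  G.Derives [Sum.inl X] (u.map Sum.inr)

/-- The language of an SLG; for an SLG it equals `{exp_G(S)}`. -/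
def language (G : SLG T N) : Set (List T) :=
  { u | G.IsExp G.start u }

/-- `Y` occurs in the parse tree of `X`. -/
def Reaches (G : SLG T N) : N → N → Prop :=
  Relation.ReflTransGen (fun X Y => Sum.inl Y ∈ G.rhs X)

/-- An SLG is admissible if every right-hand side consists of exactly two symbols and
every nonterminal occurs in the parse tree of the start symbol. -/
def Admissible (G : SLG T N) : Prop :=
  (∀ X, (G.rhs X).length = 2) ∧ (∀ X, G.Reaches G.start X)

/-- The size of an SLG: the total length of the right-hand sides of all its rules. -/
def size (G : SLG T N) [Fintype N] : ℕ :=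
  ∑ X : N, (G.rhs X).length

end SLG

section Bexp

variable {T N : Type} {n : ℕ}

/-- The bounded expansion `bexp_I`, computed with explicit fuel (for an acyclic grammar
with `n` nonterminals, fuel `n` always suffices).  The output symbols are symbols of the
grammar `G_I`: its nonterminals are `Option {i // i ∈ I}` (`some i` is `M_i`, `none` is `S`)
and its terminals are `Σ'' = T ⊕ Fin n ⊕ Fin (2n)` (terminals of `G`, dollars, hashes). -/
def bexpFuel (G : SLG T N) (e : Fin n ≃ N) (I : Finset (Fin n)) :
    ℕ → (N ⊕ T) → List ((Option {i : Fin n // i ∈ I}) ⊕ (T ⊕ Fin n ⊕ Fin (2 * n)))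
  | _, Sum.inr t => [Sum.inr (Sum.inl t)]
  | 0, Sum.inl _ => []
  | k + 1, Sum.inl X =>
    if h : e.symm X ∈ I then [Sum.inl (some ⟨e.symm X, h⟩)]
    else
      match G.rhs X with
      | [A, B] =>
          bexpFuel G e I k A
            ++ Sum.inr (Sum.inr (Sum.inl (e.symm X))) :: bexpFuel G e I k B
      | _ => []

/-- `bexp_I` applied to a symbol of `G`. -/
def bexp (G : SLG T N) (e : Fin n ≃ N) (I : Finset (Fin n)) (s : N ⊕ T) :
    List ((Option {i : Fin n // i ∈ I}) ⊕ (T ⊕ Fin n ⊕ Fin (2 * n))) :=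
  bexpFuel G e I n s

/-- The grammar `G_I`: nonterminals `{S} ∪ {M_i : i ∈ I}`, rules
`M_i → bexp_I(X) $_i bexp_I(Y)` (where `N_i → X Y` in `G`) and
`S → ⨀_{i=1..|V|} bexp_I(N_i) · #_{2i-1} · bexp_I(N_i) · #_{2i}`. -/
def GI (G : SLG T N) (e : Fin n ≃ N) (I : Finset (Fin n)) :
    SLG (T ⊕ Fin n ⊕ Fin (2 * n)) (Option {i : Fin n // i ∈ I}) where
  start := none
  rhs := fun
    | none => (List.finRange n).flatMap fun i =>
        bexp G e I (Sum.inl (e i))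
          ++ Sum.inr (Sum.inr (Sum.inr (⟨2 * i.val, by have := i.isLt; omega⟩ : Fin (2 * n))))
          :: bexp G e I (Sum.inl (e i))
          ++ [Sum.inr (Sum.inr (Sum.inr
                (⟨2 * i.val + 1, by have := i.isLt; omega⟩ : Fin (2 * n))))]
    | some j =>
        match G.rhs (e j.1) with
        | [A, B] =>
            bexp G e I A ++ Sum.inr (Sum.inr (Sum.inl j.1)) :: bexp G e I B
        | _ => []

end Bexp

section Occurrences

variable {A : Type}

/-- The set of starting positions (0-indexed) of occurrences of `p` as a substring of `t`. -/
def occSet [DecidableEq A] (p t : List A) : Finset ℕ :=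
  (Finset.range (t.length + 1)).filter fun q =>
    q + p.length ≤ t.length ∧ (t.drop q).take p.length = p

/-- Any two occurrences of `p` in `t` are non-overlapping. -/
def PairwiseNonOverlap [DecidableEq A] (p t : List A) : Prop :=
  ∀ q₁ ∈ occSet p t, ∀ q₂ ∈ occSet p t, q₁ < q₂ → q₁ + p.length ≤ q₂

end Occurrences

namespace SLG

variable {T N : Type} {G : SLG T N}

theorem Derives.append_split {x y z : List (N ⊕ T)} (h : G.Derives (x ++ y) z) :
    ∃ z₁ z₂, z = z₁ ++ z₂ ∧ G.Derives x z₁ ∧ G.Derives y z₂ := by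
  induction h with
  | refl => exact ⟨x, y, rfl, .refl, .refl⟩
  | tail _ hstep ih =>
    obtain ⟨z₁, z₂, rfl, h₁, h₂⟩ := ih
    obtain ⟨p, q, X, hx, rfl⟩ := hstep
    rcases List.append_eq_append_iff.1 hx with ⟨a, rfl, ha⟩ | ⟨a, rfl, ha⟩
    · refine ⟨z₁, a ++ G.rhs X ++ q, by simp, h₁, h₂.tail ⟨a, q, X, ha, rfl⟩⟩
    · rcases a with _ | ⟨s, a⟩
      · refine ⟨p, G.rhs X ++ q, by simp, by simpa using h₁, h₂.tail ⟨[], q, X, ?_, rfl⟩⟩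
        simpa using ha.symm
      · obtain ⟨rfl, rfl⟩ := List.cons_eq_cons.1 ha
        exact ⟨p ++ G.rhs X ++ a, z₂, by simp, h₁.tail ⟨p, a, X, rfl, rfl⟩, h₂⟩

theorem Derives.length_le (hG : G.Admissible) {x y : List (N ⊕ T)} (h : G.Derives x y) :
    x.length ≤ y.length := by
  induction h with
  | refl => exact le_rfl
  | tail _ hstep ih =>
    obtain ⟨p, q, X, rfl, rfl⟩ := hstep
    have := hG.1 X
    simp only [List.length_append, List.length_cons] at ih ⊢
    omega

theorem Derives.eq_of_terminal {t : T} {y : List (N ⊕ T)} (h : G.Derives [Sum.inr t] y) :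
    y = [Sum.inr t] := by
  rcases Relation.ReflTransGen.cases_head h with h | ⟨z, ⟨p, q, X, hx, -⟩, -⟩
  · exact h.symm
  · have : Sum.inl X ∈ [(Sum.inr t : N ⊕ T)] := by rw [hx]; simp
    simp at this

theorem Derives.of_nonterminal {X : N} {w : List T}
    (h : G.Derives [Sum.inl X] (w.map Sum.inr)) : G.Derives (G.rhs X) (w.map Sum.inr) := by
  rcases Relation.ReflTransGen.cases_head h with h | ⟨z, ⟨p, q, Y, hx, rfl⟩, hz⟩
  · have : Sum.inl X ∈ (w.map Sum.inr : List (N ⊕ T)) := by rw [← h]; simp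
    simp at this
  · rcases p with _ | ⟨s, p⟩
    · simp only [List.nil_append, List.cons.injEq, Sum.inl.injEq] at hx
      obtain ⟨rfl, rfl⟩ := hx
      rwa [List.nil_append, List.append_nil] at hz
    · simp at hx

theorem Derives.exists_split (hG : G.Admissible) {X : N} {C D : N ⊕ T} {w : List T}
    (hX : G.rhs X = [C, D]) (h : G.Derives [Sum.inl X] (w.map Sum.inr)) :
    ∃ w₁ w₂, w = w₁ ++ w₂ ∧ G.Derives [C] (w₁.map Sum.inr) ∧ G.Derives [D] (w₂.map Sum.inr) ∧
      w₁.length < w.length ∧ w₂.length < w.length := by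
  have h' := h.of_nonterminal
  rw [hX] at h'
  obtain ⟨z₁, z₂, hz, h₁, h₂⟩ := Derives.append_split (x := [C]) (y := [D]) h'
  obtain ⟨w₁, w₂, rfl, rfl, rfl⟩ := List.map_eq_append_iff.1 hz
  have l₁ := h₁.length_le hG
  have l₂ := h₂.length_le hG
  simp only [List.length_cons, List.length_nil, List.length_map] at l₁ l₂
  refine ⟨w₁, w₂, rfl, h₁, h₂, ?_, ?_⟩ <;> simp only [List.length_append] <;> omega

theorem Admissible.exists_rhs (hG : G.Admissible) (X : N) : ∃ C D, G.rhs X = [C, D] :=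
  List.length_eq_two.1 (hG.1 X)

theorem Derives.terminal_unique (hG : G.Admissible) {s : N ⊕ T} {w w' : List T}
    (h : G.Derives [s] (w.map Sum.inr)) (h' : G.Derives [s] (w'.map Sum.inr)) : w = w' := by
  induction hm : w.length using Nat.strong_induction_on generalizing s w w' with
  | _ m ih =>
    subst hm
    rcases s with X | t
    · obtain ⟨C, D, hX⟩ := hG.exists_rhs X
      obtain ⟨w₁, w₂, e₁, h₁, h₂, l₁, l₂⟩ := h.exists_split hG hX
      obtain ⟨v₁, v₂, e₂, k₁, k₂, -, -⟩ := h'.exists_split hG hX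
      rw [e₁, e₂, ih _ l₁ h₁ k₁ rfl, ih _ l₂ h₂ k₂ rfl]
    · exact List.map_injective_iff.2 Sum.inr_injective
        (h.eq_of_terminal.trans h'.eq_of_terminal.symm)

/-- The expansion of a nonterminal on a right-hand side is shorter than that of the left side. -/
theorem IsExp.length_lt (hG : G.Admissible) {X Y : N} {u v : List T} (hu : G.IsExp X u)
    (hv : G.IsExp Y v) (hY : Sum.inl Y ∈ G.rhs X) : v.length < u.length := by
  obtain ⟨C, D, hX⟩ := hG.exists_rhs X
  obtain ⟨w₁, w₂, -, h₁, h₂, l₁, l₂⟩ := Derives.exists_split hG hX hu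
  rw [hX] at hY
  rcases List.mem_pair.1 hY with rfl | rfl
  · rwa [Derives.terminal_unique hG hv h₁]
  · rwa [Derives.terminal_unique hG hv h₂]

theorem symm_lt_of_mem_rhs {n : ℕ} {e : Fin n ≃ N} (hG : G.Admissible)
    {expn : N → List T} (hexpn : ∀ X, G.IsExp X (expn X))
    (hord : ∀ i j : Fin n, i ≤ j → (expn (e i)).length ≤ (expn (e j)).length)
    {X Y : N} (hY : Sum.inl Y ∈ G.rhs X) : e.symm Y < e.symm X := by
  by_contra! h
  have := hord _ _ h
  simp only [Equiv.apply_symm_apply] at this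
  exact absurd (IsExp.length_lt hG (hexpn X) (hexpn Y) hY) (by omega)

end SLG

section Bexp

variable {T N : Type} {n : ℕ} {G : SLG T N} {e : Fin n ≃ N}

theorem bexpFuel_congr (hlt : ∀ X Y, Sum.inl Y ∈ G.rhs X → e.symm Y < e.symm X)
    (I : Finset (Fin n)) {s : N ⊕ T} {k k' : ℕ} (hk : ∀ X, s = Sum.inl X → (e.symm X : ℕ) < k)
    (hk' : ∀ X, s = Sum.inl X → (e.symm X : ℕ) < k') :
    bexpFuel G e I k s = bexpFuel G e I k' s := by
  induction k generalizing k' s with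
  | zero =>
    rcases s with X | t
    · exact absurd (hk X rfl) (by omega)
    · simp [bexpFuel]
  | succ k ih =>
    rcases s with X | t
    · rcases k' with _ | k'
      · exact absurd (hk' X rfl) (by omega)
      · have h₁ := hk X rfl
        have h₂ := hk' X rfl
        have key : ∀ Z ∈ G.rhs X, bexpFuel G e I k Z = bexpFuel G e I k' Z := by
          intro Z hZ
          refine ih ?_ ?_ <;> rintro Y rfl <;> have := Fin.lt_def.1 (hlt X Y hZ) <;> omega
        simp only [bexpFuel]
        split_ifs
        · rfl
        · split
          · rename_i C D hX
            rw [key C (by simp [hX]), key D (by simp [hX])]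
          · rfl
    · simp [bexpFuel]

theorem bexp_terminal (I : Finset (Fin n)) (t : T) :
    bexp G e I (Sum.inr t) = [Sum.inr (Sum.inl t)] := by
  simp [bexp, bexpFuel]

theorem bexp_of_mem {I : Finset (Fin n)} {j : Fin n} (hj : j ∈ I) :
    bexp G e I (Sum.inl (e j)) = [Sum.inl (some ⟨j, hj⟩)] := by
  obtain ⟨m, rfl⟩ : ∃ m, n = m + 1 := ⟨n - 1, by have := j.isLt; omega⟩
  simp [bexp, bexpFuel, hj]

theorem bexp_of_notMem (hlt : ∀ X Y, Sum.inl Y ∈ G.rhs X → e.symm Y < e.symm X)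
    {I : Finset (Fin n)} {j : Fin n} (hj : j ∉ I) {C D : N ⊕ T} (hX : G.rhs (e j) = [C, D]) :
    bexp G e I (Sum.inl (e j)) =
      bexp G e I C ++ Sum.inr (Sum.inr (Sum.inl j)) :: bexp G e I D := by
  obtain ⟨m, rfl⟩ : ∃ m, n = m + 1 := ⟨n - 1, by have := j.isLt; omega⟩
  have key : ∀ Z ∈ G.rhs (e j), bexpFuel G e I m Z = bexpFuel G e I (m + 1) Z := by
    intro Z hZ
    refine bexpFuel_congr hlt I ?_ (fun X _ => (e.symm X).isLt)
    rintro Y rfl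
    have := Fin.lt_def.1 (hlt _ Y hZ)
    rw [Equiv.symm_apply_apply] at this
    have := j.isLt
    omega
  rw [bexp, bexpFuel]
  simp only [Equiv.symm_apply_apply, hj, dite_false]
  simp only [hX]
  rw [key C (by simp [hX]), key D (by simp [hX])]
  rfl

/-- Induction over the symbols of a grammar whose rules only refer to smaller nonterminals. -/
theorem symbol_induction (hG : G.Admissible)
    (hlt : ∀ X Y, Sum.inl Y ∈ G.rhs X → e.symm Y < e.symm X) {P : N ⊕ T → Prop}
    (terminal : ∀ t, P (Sum.inr t))
    (nonterminal : ∀ j C D, G.rhs (e j) = [C, D] → P C → P D → P (Sum.inl (e j)))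
    (s : N ⊕ T) : P s := by
  have main : ∀ j, P (Sum.inl (e j)) := by
    intro j
    induction j using WellFoundedLT.induction with
    | _ j ih =>
      obtain ⟨C, D, hX⟩ := hG.exists_rhs (e j)
      have key : ∀ Z ∈ G.rhs (e j), P Z := by
        rintro (Y | t) hZ
        · have := hlt _ _ hZ
          rw [Equiv.symm_apply_apply] at this
          simpa using ih _ this
        · exact terminal t
      exact nonterminal j C D hX (key C (by simp [hX])) (key D (by simp [hX]))
  rcases s with X | t
  · simpa using main (e.symm X)
  · exact terminal t

theorem le_of_dollar_mem_bexp (hG : G.Admissible)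
    (hlt : ∀ X Y, Sum.inl Y ∈ G.rhs X → e.symm Y < e.symm X) {I : Finset (Fin n)}
    {i : Fin n} {s : N ⊕ T} (h : Sum.inr (Sum.inr (Sum.inl i)) ∈ bexp G e I s) :
    ∃ X, s = Sum.inl X ∧ i ≤ e.symm X := by
  induction s using symbol_induction hG hlt with
  | terminal t => simp [bexp_terminal] at h
  | nonterminal j C D hX ihC ihD =>
    refine ⟨_, rfl, ?_⟩
    rw [Equiv.symm_apply_apply]
    by_cases hj : j ∈ I
    · simp [bexp_of_mem hj] at h
    · have key : ∀ Z ∈ G.rhs (e j), (∃ X, Z = Sum.inl X ∧ i ≤ e.symm X) → i ≤ j := by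
        rintro Z hZ ⟨Y, rfl, hY⟩
        have := hlt _ _ hZ
        rw [Equiv.symm_apply_apply] at this
        exact hY.trans this.le
      rw [bexp_of_notMem hlt hj hX, List.mem_append, List.mem_cons] at h
      rcases h with h | h | h
      · exact key C (by simp [hX]) (ihC h)
      · simp only [Sum.inr.injEq, Sum.inl.injEq] at h
        exact h.le
      · exact key D (by simp [hX]) (ihD h)

end Bexp

instance Sum.instLawfulBEq {α β : Type*} [BEq α] [BEq β] [LawfulBEq α] [LawfulBEq β] :
    LawfulBEq (α ⊕ β) where
  rfl {x} := by
    rcases x with x | x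
    · exact beq_self_eq_true x
    · exact beq_self_eq_true x
  eq_of_beq {x y} h := by
    rcases x with x | x <;> rcases y with y | y
    · exact congrArg Sum.inl (eq_of_beq (a := x) (b := y) h)
    · exact absurd h Bool.false_ne_true
    · exact absurd h Bool.false_ne_true
    · exact congrArg Sum.inr (eq_of_beq (a := x) (b := y) h)

section Occurrences

variable {A : Type} [DecidableEq A]

theorem mem_occSet {p t : List A} {q : ℕ} :
    q ∈ occSet p t ↔ ∃ a b, t = a ++ (p ++ b) ∧ a.length = q := by
  simp only [occSet, Finset.mem_filter, Finset.mem_range]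
  constructor
  · rintro ⟨-, h, hp⟩
    refine ⟨t.take q, (t.drop q).drop p.length, ?_, ?_⟩
    · conv_rhs => rw [← hp]
      rw [List.length_take, List.length_drop, min_eq_left (by omega), List.take_append_drop,
        List.take_append_drop]
    · rw [List.length_take]
      omega
  · rintro ⟨a, b, rfl, rfl⟩
    simp only [List.length_append, List.drop_left, List.take_left, and_true]
    omega

theorem occSet_eq_empty {p t : List A} {d : A} (hp : d ∈ p) (ht : d ∉ t) : occSet p t = ∅ := by
  ext q
  simp only [mem_occSet, Finset.notMem_empty, iff_false]
  rintro ⟨a, b, rfl, -⟩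
  simp [hp] at ht

theorem occSet_self (p : List A) : occSet p p = {0} := by
  ext q
  simp only [mem_occSet, Finset.mem_singleton]
  constructor
  · rintro ⟨a, b, h, rfl⟩
    have := congrArg List.length h
    simp only [List.length_append] at this
    omega
  · rintro rfl
    exact ⟨[], [], by simp⟩

theorem occSet_append_cons {p u v : List A} {c : A} (hp : p ≠ []) (hc : c ∉ p) :
    occSet p (u ++ c :: v) =
      occSet p u ∪ (occSet p v).map (addLeftEmbedding (u.length + 1)) := by
  ext q
  simp only [Finset.mem_union, Finset.mem_map, mem_occSet, addLeftEmbedding_apply]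
  constructor
  · rintro ⟨a, b, h, rfl⟩
    rcases List.append_eq_append_iff.1 h with ⟨a', rfl, h'⟩ | ⟨c', rfl, h'⟩
    · rcases a' with _ | ⟨x, a'⟩
      · rcases p with _ | ⟨y, p⟩
        · exact absurd rfl hp
        · simp only [List.nil_append, List.cons_append, List.cons.injEq] at h'
          simp [h'.1] at hc
      · simp only [List.cons_append, List.cons.injEq] at h'
        refine Or.inr ⟨a'.length, ⟨a', b, h'.2, rfl⟩, ?_⟩
        simp only [List.length_append, List.length_cons]
        omega
    · left
      rcases List.append_eq_append_iff.1 h' with ⟨d, rfl, h''⟩ | ⟨d, rfl, h''⟩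
      · exact ⟨a, d, rfl, rfl⟩
      · rcases d with _ | ⟨x, d⟩
        · exact ⟨a, [], by simp, rfl⟩
        · simp only [List.cons_append, List.cons.injEq] at h''
          simp [h''.1] at hc
  · rintro (⟨a, b, rfl, rfl⟩ | ⟨_, ⟨a, b, rfl, rfl⟩, rfl⟩)
    · exact ⟨a, b ++ c :: v, by simp, rfl⟩
    · refine ⟨u ++ c :: a, b, by simp, ?_⟩
      simp only [List.length_append, List.length_cons]
      omega

theorem length_le_of_mem_occSet {p t : List A} {q : ℕ} (h : q ∈ occSet p t) :
    q + p.length ≤ t.length := by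
  obtain ⟨a, b, rfl, rfl⟩ := mem_occSet.1 h
  simp only [List.length_append]
  omega

theorem card_occSet_append_cons {p u v : List A} {c : A} (hp : p ≠ []) (hc : c ∉ p) :
    (occSet p (u ++ c :: v)).card = (occSet p u).card + (occSet p v).card := by
  rw [occSet_append_cons hp hc, Finset.card_union_of_disjoint, Finset.card_map]
  rw [Finset.disjoint_left]
  intro q hq hq'
  obtain ⟨r, -, rfl⟩ := Finset.mem_map.1 hq'
  have := length_le_of_mem_occSet hq
  rw [addLeftEmbedding_apply] at this
  omega

theorem PairwiseNonOverlap.append_cons {p u v : List A} {c : A} (hp : p ≠ []) (hc : c ∉ p)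
    (hu : PairwiseNonOverlap p u) (hv : PairwiseNonOverlap p v) :
    PairwiseNonOverlap p (u ++ c :: v) := by
  intro q₁ h₁ q₂ h₂ hlt
  simp only [occSet_append_cons hp hc, Finset.mem_union, Finset.mem_map,
    addLeftEmbedding_apply] at h₁ h₂
  rcases h₁ with h₁ | ⟨r₁, h₁, rfl⟩ <;> rcases h₂ with h₂ | ⟨r₂, h₂, rfl⟩
  · exact hu _ h₁ _ h₂ hlt
  · have := length_le_of_mem_occSet h₁
    omega
  · have := length_le_of_mem_occSet h₂
    omega
  · have := hv _ h₁ _ h₂ (by omega)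
    omega

end Occurrences

/-- Let `I ⊆ {1, …, |V|}` and `i ∈ {1, …, |V|} \ I`.  Then for every
`j ∈ {1, …, |V|}` the number of occurrences of the symbol `$_i` in `bexp_I(N_j)` equals
the number of occurrences of the string `bexp_I(N_i)` in `bexp_I(N_j)`, and any two
occurrences of `bexp_I(N_i)` in `bexp_I(N_j)` are non-overlapping. -/
theorem bexp_occurrences {T N : Type} [DecidableEq T] [Fintype N] {n : ℕ} (e : Fin n ≃ N)
    (G : SLG T N) (hG : G.Admissible)
    (expn : N → List T) (hexpn : ∀ X, G.IsExp X (expn X))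
    (hord : ∀ i j : Fin n, i ≤ j → (expn (e i)).length ≤ (expn (e j)).length)
    (I : Finset (Fin n)) (i : Fin n) (hi : i ∉ I) :
    ∀ j : Fin n,
      (bexp G e I (Sum.inl (e j))).count (Sum.inr (Sum.inr (Sum.inl i))) =
        (occSet (bexp G e I (Sum.inl (e i))) (bexp G e I (Sum.inl (e j)))).card ∧
      PairwiseNonOverlap (bexp G e I (Sum.inl (e i))) (bexp G e I (Sum.inl (e j))) := by
  have hlt : ∀ X Y, Sum.inl Y ∈ G.rhs X → e.symm Y < e.symm X :=
    fun _ _ => SLG.symm_lt_of_mem_rhs hG hexpn hord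
  obtain ⟨C₀, D₀, hi₀⟩ := hG.exists_rhs (e i)
  set p := bexp G e I (Sum.inl (e i)) with hp
  have hpi := bexp_of_notMem hlt hi hi₀
  rw [← hp] at hpi
  have hmem : Sum.inr (Sum.inr (Sum.inl i)) ∈ p := by rw [hpi]; simp
  have hne : p ≠ [] := List.ne_nil_of_mem hmem
  have child : ∀ Z ∈ G.rhs (e i), Sum.inr (Sum.inr (Sum.inl i)) ∉ bexp G e I Z := by
    intro Z hZ h
    obtain ⟨Y, rfl, hY⟩ := le_of_dollar_mem_bexp hG hlt h
    have := hlt _ _ hZ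
    rw [Equiv.symm_apply_apply] at this
    exact absurd hY this.not_ge
  have absent : ∀ t, Sum.inr (Sum.inr (Sum.inl i)) ∉ t →
      t.count (Sum.inr (Sum.inr (Sum.inl i))) = (occSet p t).card ∧ PairwiseNonOverlap p t := by
    intro t ht
    simp [PairwiseNonOverlap, occSet_eq_empty hmem ht, List.count_eq_zero_of_not_mem ht]
  suffices main : ∀ s : N ⊕ T,
      (bexp G e I s).count (Sum.inr (Sum.inr (Sum.inl i))) = (occSet p (bexp G e I s)).card ∧
      PairwiseNonOverlap p (bexp G e I s) from fun j => main _
  intro s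
  induction s using symbol_induction hG hlt with
  | terminal t => exact absent _ (by simp [bexp_terminal])
  | nonterminal j C D hX ihC ihD =>
    by_cases hj : j ∈ I
    · exact absent _ (by simp [bexp_of_mem hj])
    rcases lt_trichotomy j i with hji | rfl | hij
    · refine absent _ fun h => ?_
      obtain ⟨Y, hY, hle⟩ := le_of_dollar_mem_bexp hG hlt h
      obtain rfl := Sum.inl_injective hY
      rw [Equiv.symm_apply_apply] at hle
      exact absurd hle hji.not_ge
    · rw [← hp]
      constructor
      · rw [occSet_self, hpi, List.count_append, List.count_cons_self,
          List.count_eq_zero_of_not_mem (child C₀ (by simp [hi₀])),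
          List.count_eq_zero_of_not_mem (child D₀ (by simp [hi₀]))]
        rfl
      · simp [PairwiseNonOverlap, occSet_self]
    · have hc : Sum.inr (Sum.inr (Sum.inl j)) ∉ p := by
        intro h
        obtain ⟨Y, hY, hle⟩ := le_of_dollar_mem_bexp hG hlt h
        obtain rfl := Sum.inl_injective hY
        rw [Equiv.symm_apply_apply] at hle
        exact absurd hle hij.not_ge
      rw [bexp_of_notMem hlt hj hX]
      refine ⟨?_, .append_cons hne hc ihC.2 ihD.2⟩
      rw [card_occSet_append_cons hne hc, ← ihC.1, ← ihD.1, List.count_append,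
        List.count_cons_of_ne (by simpa using hij.ne')]
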